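/- Let 1 < p < ∞ and let 𝓜 be a nonzero ideal of the ring M^p. Then 𝓜 contains a bounded holomorphic function on 𝔻 which is not identically zero. -/

import Mathlib

open MeasureTheory Filter Set
open scoped ENNReal Topology Real NNReal

noncomputable section

/-- The open unit disk in the complex plane. -/
def unitDisk : Set ℂ := Metric.ball 0 1

/-- The point `r·e^{iθ}`. -/
def circlePt (r θ : ℝ) : ℂ := (r : ℂ) * Complex.exp (θ * Complex.I)

/-- The maximal radial function `Mf(θ) = sup_{0 ≤ r < 1} |f(r e^{iθ})|`, valued in `ℝ≥0∞`. -/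
def maxRad (f : ℂ → ℂ) (θ : ℝ) : ℝ≥0∞ :=
  ⨆ r ∈ Set.Ico (0 : ℝ) 1, (‖f (circlePt r θ)‖₊ : ℝ≥0∞)

/-- `log⁺` on `ℝ≥0∞`. -/
def elogPlus (x : ℝ≥0∞) : ℝ≥0∞ :=
  if x = ∞ then ∞ else ENNReal.ofReal (Real.log x.toReal)

/-- `x ↦ log (1 + x)` on `ℝ≥0∞`. -/
def elog1p (x : ℝ≥0∞) : ℝ≥0∞ :=
  if x = ∞ then ∞ else ENNReal.ofReal (Real.log (1 + x.toReal))

/-- The radial boundary value `f*(e^{iθ}) = lim_{r→1⁻} f(r e^{iθ})`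
(a junk value is returned where the limit does not exist). -/
def radialLimit (f : ℂ → ℂ) (θ : ℝ) : ℂ :=
  limUnder (nhdsWithin (1 : ℝ) (Set.Iio 1)) fun r : ℝ => f (circlePt r θ)

/-- The class `M^p`: holomorphic functions on the unit disk with
`∫₀^{2π} (log⁺ Mf(θ))^p dθ/2π < ∞`. -/
def MpClass (p : ℝ) : Set (ℂ → ℂ) :=
  {f | DifferentiableOn ℂ f unitDisk ∧
    (∫⁻ θ in Set.Ioc 0 (2 * π), elogPlus (maxRad f θ) ^ p) / ENNReal.ofReal (2 * π) < ∞}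

/-- The metric `ρ_p` on `M^p`. -/
def rhoMetric (p : ℝ) (f g : ℂ → ℂ) : ℝ≥0∞ :=
  ((∫⁻ θ in Set.Ioc 0 (2 * π), elog1p (maxRad (f - g) θ) ^ p) /
    ENNReal.ofReal (2 * π)) ^ (1 / p)

/-- The Privalov class `N^p`: holomorphic functions on the unit disk with
`sup_{0≤r<1} ∫₀^{2π} (log⁺|f(re^{iθ})|)^p dθ/2π < ∞`. -/
def NpClass (p : ℝ) : Set (ℂ → ℂ) :=
  {f | DifferentiableOn ℂ f unitDisk ∧
    (⨆ r ∈ Set.Ico (0 : ℝ) 1,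
      (∫⁻ θ in Set.Ioc 0 (2 * π),
        ENNReal.ofReal (Real.log ‖f (circlePt r θ)‖) ^ p) / ENNReal.ofReal (2 * π)) < ∞}

/-- The metric `d_p` on `N^p`, defined via boundary values. -/
def dMetric (p : ℝ) (f g : ℂ → ℂ) : ℝ≥0∞ :=
  ((∫⁻ θ in Set.Ioc 0 (2 * π),
      ENNReal.ofReal (Real.log (1 + ‖radialLimit f θ - radialLimit g θ‖)) ^ p) /
    ENNReal.ofReal (2 * π)) ^ (1 / p)

/-- The Hardy space `H^p`. -/
def HpClass (p : ℝ) : Set (ℂ → ℂ) :=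
  {f | DifferentiableOn ℂ f unitDisk ∧
    (⨆ r ∈ Set.Ico (0 : ℝ) 1,
      (∫⁻ θ in Set.Ioc 0 (2 * π), (‖f (circlePt r θ)‖₊ : ℝ≥0∞) ^ p) /
        ENNReal.ofReal (2 * π)) < ∞}

/-- The Smirnov class `N⁺`. -/
def SmirnovClass : Set (ℂ → ℂ) :=
  {f | DifferentiableOn ℂ f unitDisk ∧
    (∫⁻ θ in Set.Ioc 0 (2 * π), ENNReal.ofReal (Real.log ‖radialLimit f θ‖)) /
      ENNReal.ofReal (2 * π) < ∞ ∧
    Tendsto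
      (fun r : ℝ => (∫⁻ θ in Set.Ioc 0 (2 * π),
        ENNReal.ofReal (Real.log ‖f (circlePt r θ)‖)) / ENNReal.ofReal (2 * π))
      (nhdsWithin (1 : ℝ) (Set.Iio 1))
      (nhds ((∫⁻ θ in Set.Ioc 0 (2 * π),
        ENNReal.ofReal (Real.log ‖radialLimit f θ‖)) / ENNReal.ofReal (2 * π)))}

/-- The normalized Blaschke factor `(|a|/a)·(a − z)/(1 − conj a · z)`. -/
def blaschkeFactor (a z : ℂ) : ℂ :=
  ((‖a‖ : ℂ) / a) * ((a - z) / (1 - (starRingEnd ℂ) a * z))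

/-- `B` is a (finite or infinite) Blaschke product on the unit disk. -/
def IsBlaschkeProduct (B : ℂ → ℂ) : Prop :=
  ∃ m : ℕ,
    (∃ n : ℕ, ∃ a : ℕ → ℂ, (∀ k < n, a k ∈ unitDisk ∧ a k ≠ 0) ∧
      ∀ z ∈ unitDisk, B z = z ^ m * ∏ k ∈ Finset.range n, blaschkeFactor (a k) z) ∨
    (∃ a : ℕ → ℂ, (∀ k, a k ∈ unitDisk ∧ a k ≠ 0) ∧ (Summable fun k => 1 - ‖a k‖) ∧
      ∀ z ∈ unitDisk, B z = z ^ m * ∏' k, blaschkeFactor (a k) z)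

/-- `I` is an ideal of the ring `M^p`. -/
structure IsIdealIn (p : ℝ) (I : Set (ℂ → ℂ)) : Prop where
  subset : I ⊆ MpClass p
  zero_mem : (0 : ℂ → ℂ) ∈ I
  add_mem : ∀ f ∈ I, ∀ g ∈ I, f + g ∈ I
  neg_mem : ∀ f ∈ I, -f ∈ I
  mul_mem : ∀ f ∈ MpClass p, ∀ g ∈ I, f * g ∈ I

/-- `I` is a prime ideal of the ring `M^p`: an ideal such that whenever a product of two
elements of `M^p` lies in `I`, one of the factors lies in `I`. -/
def IsPrimeIdealIn (p : ℝ) (I : Set (ℂ → ℂ)) : Prop :=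
  IsIdealIn p I ∧ ∀ f ∈ MpClass p, ∀ g ∈ MpClass p, f * g ∈ I → f ∈ I ∨ g ∈ I

/-- `I` is a dense subset of the metric space `(M^p, ρ_p)`. -/
def IsDenseIn (p : ℝ) (I : Set (ℂ → ℂ)) : Prop :=
  ∀ f ∈ MpClass p, ∀ ε : ℝ≥0∞, 0 < ε → ∃ g ∈ I, rhoMetric p f g < ε

/-- `I` is an ideal of the ring `N^p`. -/
structure IsIdealInNp (p : ℝ) (I : Set (ℂ → ℂ)) : Prop where
  subset : I ⊆ NpClass p
  zero_mem : (0 : ℂ → ℂ) ∈ I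
  add_mem : ∀ f ∈ I, ∀ g ∈ I, f + g ∈ I
  neg_mem : ∀ f ∈ I, -f ∈ I
  mul_mem : ∀ f ∈ NpClass p, ∀ g ∈ I, f * g ∈ I

/-- `I` is a prime ideal of the ring `N^p`. -/
def IsPrimeIdealInNp (p : ℝ) (I : Set (ℂ → ℂ)) : Prop :=
  IsIdealInNp p I ∧ ∀ f ∈ NpClass p, ∀ g ∈ NpClass p, f * g ∈ I → f ∈ I ∨ g ∈ I

/-- `I` is a dense subset of the metric space `(N^p, d_p)`. -/
def IsDenseInNp (p : ℝ) (I : Set (ℂ → ℂ)) : Prop :=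
  ∀ f ∈ NpClass p, ∀ ε : ℝ≥0∞, 0 < ε → ∃ g ∈ I, dMetric p f g < ε


section Helpers
open Real

lemma norm_sub_le_norm_one_sub {u w : ℂ} (hu : ‖u‖ ≤ 1) (hw : ‖w‖ ≤ 1) :
    ‖w - u‖ ≤ ‖1 - (starRingEnd ℂ) u * w‖ := by
  have h1 : ‖u‖ ^ 2 ≤ 1 := by nlinarith [norm_nonneg u]
  have h2 : ‖w‖ ^ 2 ≤ 1 := by nlinarith [norm_nonneg w]
  apply le_of_sq_le_sq _ (norm_nonneg _)
  rw [← Complex.normSq_eq_norm_sq, Complex.normSq_apply] at h1 h2 ⊢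
  rw [← Complex.normSq_eq_norm_sq, Complex.normSq_apply]
  simp
  nlinarith [mul_nonneg (sub_nonneg.2 h1) (sub_nonneg.2 h2)]

lemma continuousOn_reK {w : ℂ} (hw : w ∈ Metric.ball (0 : ℂ) 1) :
    ContinuousOn (Complex.re ∘ herglotzRieszKernel 0 w) (Metric.sphere 0 |(1 : ℝ)|) :=
  Complex.continuous_re.comp_continuousOn (continuousOn_herglotzRieszKernel_sphere hw)

lemma reK_nonneg {w z : ℂ} (hw : w ∈ Metric.ball (0 : ℂ) 1) (hz : z ∈ Metric.sphere (0 : ℂ) 1) :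
    0 ≤ (Complex.re ∘ herglotzRieszKernel 0 w) z := by
  have h := le_re_herglotzRieszKernel hz hw
  have hw' : ‖w‖ < 1 := by simpa using hw
  refine le_trans ?_ h
  simp only [sub_zero]
  exact div_nonneg (by linarith) (by positivity)

lemma linear_factor_le {u w : ℂ} (hu : u ∈ Metric.closedBall (0 : ℂ) 1)
    (hw : w ∈ Metric.ball (0 : ℂ) 1) (huw : w ≠ u) :
    Real.log ‖w - u‖ ≤ Real.circleAverage
      ((Complex.re ∘ herglotzRieszKernel 0 w) • (fun z => Real.log ‖z - u‖)) 0 1 := by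
  have hw' : ‖w‖ < 1 := by simpa using hw
  have hu' : ‖u‖ ≤ 1 := by simpa using hu
  rcases eq_or_lt_of_le hu' with h | h
  · rw [circleAverage_re_herglotzRieszKernel_mul_log₀ (by simpa using h) hw]
  · have hne : ∀ z ∈ Metric.closedBall (0 : ℂ) 1, 1 - (starRingEnd ℂ) u * z ≠ 0 := by
      intro z hz h0
      have hz' : ‖z‖ ≤ 1 := by simpa using hz
      have : ‖(starRingEnd ℂ) u * z‖ = 1 := by rw [← sub_eq_zero.1 h0]; simp
      rw [norm_mul, RCLike.norm_conj] at this
      nlinarith [norm_nonneg u, norm_nonneg z]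
    have key := InnerProductSpace.HarmonicOnNhd.circleAverage_re_herglotzRieszKernel_smul
      (f := fun z => Real.log ‖1 - (starRingEnd ℂ) u * z‖) (c := 0) (R := 1) (w := w)
      (fun z hz => AnalyticAt.harmonicAt_log_norm (by fun_prop) (hne z hz)) hw
    rw [circleAverage_congr_sphere (f₂ := (Complex.re ∘ herglotzRieszKernel 0 w) •
      (fun z => Real.log ‖1 - (starRingEnd ℂ) u * z‖)), key]
    · apply Real.log_le_log
      · exact norm_pos_iff.2 (sub_ne_zero.2 huw)
      · exact norm_sub_le_norm_one_sub hu' hw'.le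
    · intro z hz
      have hz' : ‖z‖ = 1 := by simpa using hz
      have : ‖z - u‖ = ‖1 - (starRingEnd ℂ) u * z‖ := by
        have h3 : 1 - (starRingEnd ℂ) u * z = z * (starRingEnd ℂ) (z - u) := by
          have : z * (starRingEnd ℂ) z = 1 := by
            rw [Complex.mul_conj, Complex.normSq_eq_norm_sq, hz']; simp
          rw [map_sub, mul_sub, this]; ring
        rw [h3, norm_mul, hz', RCLike.norm_conj, one_mul]
      simp [this]

lemma log_norm_le_poisson {f : ℂ → ℂ} (hf : AnalyticOnNhd ℂ f (Metric.closedBall 0 1))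
    {w : ℂ} (hw : w ∈ Metric.ball (0 : ℂ) 1) (hfw : f w ≠ 0) :
    CircleIntegrable ((Complex.re ∘ herglotzRieszKernel 0 w) • (fun z => Real.log ‖f z‖)) 0 1 ∧
    Real.log ‖f w‖ ≤ Real.circleAverage
      ((Complex.re ∘ herglotzRieszKernel 0 w) • (fun z => Real.log ‖f z‖)) 0 1 := by
  have hKc := continuousOn_reK hw
  have hwC : w ∈ Metric.closedBall (0 : ℂ) 1 := Metric.ball_subset_closedBall hw
  refine ⟨CircleIntegrable.continuousOn_smul (MeromorphicOn.circleIntegrable_log_norm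
      (fun z hz => (hf z (Metric.sphere_subset_closedBall (by simpa using hz))).meromorphicAt)) hKc, ?_⟩
  have hord : ∀ u : Metric.closedBall (0 : ℂ) 1, meromorphicOrderAt f u ≠ ⊤ := by
    refine (hf.meromorphicOn.exists_meromorphicOrderAt_ne_top_iff_forall
      ⟨Metric.nonempty_closedBall.mpr zero_le_one,
        (convex_closedBall (0 : ℂ) 1).isPreconnected⟩).1 ⟨⟨w, hwC⟩, ?_⟩
    have := (hf w hwC).meromorphicNFAt.meromorphicOrderAt_eq_zero_iff.2 hfw
    simp [this]
  set D := MeromorphicOn.divisor f (Metric.closedBall (0 : ℂ) 1) with hD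
  have hfin := D.finiteSupport (isCompact_closedBall (0 : ℂ) 1)
  obtain ⟨g, h₁g, h₂g, h₃g⟩ := hf.meromorphicOn.extract_zeros_poles hord hfin
  have h₄g := MeromorphicOn.extract_zeros_poles_log h₂g h₃g
  have hacc : AccPt w (𝓟 (Metric.closedBall (0 : ℂ) 1)) := by
    apply accPt_iff_frequently_nhdsNE.mpr
    apply compl_notMem
    apply mem_nhdsWithin.mpr
    exact ⟨Metric.ball 0 1, Metric.isOpen_ball, hw, fun _ h => Metric.ball_subset_closedBall h.1⟩
  have hval := MeromorphicOn.log_norm_meromorphicTrailingCoeffAt_extract_zeros_poles hfin hwC hacc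
    (hf w hwC).meromorphicAt (h₁g w hwC) (h₂g ⟨w, hwC⟩) h₃g
  rw [(hf w hwC).meromorphicTrailingCoeffAt_of_ne_zero hfw] at hval
  have hDw : D w = 0 := by
    rw [hD, MeromorphicOn.AnalyticOnNhd.divisor_apply hf hwC, (hf w hwC).analyticOrderAt_eq_zero.mpr hfw]; rfl
  have hs1 : ∀ (F : ℂ → ℂ → ℝ), (∑ᶠ u, fun z => (D u : ℝ) * F u z)
      = ∑ u ∈ hfin.toFinset, fun z => (D u : ℝ) * F u z := by
    intro F
    rw [finsum_eq_sum_of_support_subset]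
    intro u
    contrapose
    intro h
    have : D u = 0 := by simpa using h
    simp [this]; rfl
  have hs2 : ∑ᶠ u, (D u : ℝ) * Real.log ‖w - u‖ = ∑ u ∈ hfin.toFinset, (D u : ℝ) * Real.log ‖w - u‖ := by
    rw [finsum_eq_sum_of_support_subset]
    intro u
    contrapose
    intro h
    have : D u = 0 := by simpa using h
    simp [this]
  have hint : ∀ u, CircleIntegrable ((Complex.re ∘ herglotzRieszKernel 0 w) •
      (fun z => Real.log ‖z - u‖)) 0 1 := fun u =>
    CircleIntegrable.continuousOn_smul (MeromorphicOn.circleIntegrable_log_norm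
      (f := fun z => z - u) (by intro z _; fun_prop)) hKc
  have hintg : CircleIntegrable ((Complex.re ∘ herglotzRieszKernel 0 w) •
      (fun z => Real.log ‖g z‖)) 0 1 := 
    CircleIntegrable.continuousOn_smul (MeromorphicOn.circleIntegrable_log_norm
      (fun z hz => (h₁g z (Metric.sphere_subset_closedBall (by simpa using hz))).meromorphicAt)) hKc
  have hP : Real.circleAverage
      ((Complex.re ∘ herglotzRieszKernel 0 w) • (fun z => Real.log ‖f z‖)) 0 1
      = ∑ u ∈ hfin.toFinset, (D u : ℝ) * Real.circleAverage
        ((Complex.re ∘ herglotzRieszKernel 0 w) • (fun z => Real.log ‖z - u‖)) 0 1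
        + Real.log ‖g w‖ := by
    have hg0 := InnerProductSpace.HarmonicOnNhd.circleAverage_re_herglotzRieszKernel_smul
      (f := fun z => Real.log ‖g z‖) (c := 0) (R := 1) (w := w)
      (fun z hz => AnalyticAt.harmonicAt_log_norm (h₁g z hz) (h₂g ⟨z, hz⟩)) hw
    rw [← hg0]
    have : ∀ u ∈ hfin.toFinset, (D u : ℝ) * Real.circleAverage
        ((Complex.re ∘ herglotzRieszKernel 0 w) • (fun z => Real.log ‖z - u‖)) 0 1
        = Real.circleAverage ((D u : ℝ) • ((Complex.re ∘ herglotzRieszKernel 0 w) •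
          (fun z => Real.log ‖z - u‖))) 0 1 := by
      intro u _
      rw [circleAverage_smul]; rfl
    rw [Finset.sum_congr rfl this, ← circleAverage_sum, ← circleAverage_add]
    · apply circleAverage_congr_codiscreteWithin _ one_ne_zero
      rw [abs_one]
      have h5 := codiscreteWithin_mono Metric.sphere_subset_closedBall h₄g
      filter_upwards [h5] with z hz
      rw [hs1] at hz
      simp only [Pi.add_apply, Finset.sum_apply, Pi.smul_apply', Pi.smul_apply, smul_eq_mul] at hz ⊢
      rw [hz, mul_add, Finset.mul_sum]
      congr 1
      exact Finset.sum_congr rfl fun u _ => by simp only [Pi.mul_apply]; ring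
    · exact CircleIntegrable.sum _ fun u _ => (hint u).const_smul
    · exact hintg
    · exact fun u _ => (hint u).const_smul
  rw [hP, hval, hs2]
  gcongr with u hu
  · exact_mod_cast (MeromorphicOn.AnalyticOnNhd.divisor_nonneg hf u)
  · have hDu : D u ≠ 0 := by simpa using hu
    apply linear_factor_le _ hw
    · rintro rfl; exact hDu hDw
    · exact D.supportWithinDomain hDu

lemma elogPlus_mono : Monotone elogPlus := by
  intro x y hxy
  unfold elogPlus
  by_cases hy : y = ∞
  · simp [hy]
  have hx : x ≠ ∞ := ne_top_of_le_ne_top hy hxy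
  rw [if_neg hx, if_neg hy]
  have h := ENNReal.toReal_mono hy hxy
  rcases (ENNReal.toReal_nonneg (a := x)).eq_or_lt with h0 | h0
  · simp [← h0]
  · exact ENNReal.ofReal_le_ofReal (Real.log_le_log h0 h)

lemma circlePt_mem {r : ℝ} (hr : r ∈ Set.Ico (0 : ℝ) 1) (θ : ℝ) : circlePt r θ ∈ unitDisk := by
  simp [unitDisk, circlePt, Complex.norm_exp_ofReal_mul_I, abs_of_nonneg hr.1, hr.2]

lemma measurable_maxRad {f : ℂ → ℂ} (hf : DifferentiableOn ℂ f unitDisk) :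
    Measurable (maxRad f) := by
  apply LowerSemicontinuous.measurable
  unfold maxRad
  apply lowerSemicontinuous_iSup
  intro r
  apply lowerSemicontinuous_iSup
  intro hr
  apply Continuous.lowerSemicontinuous
  have : Continuous fun θ => f (circlePt r θ) :=
    hf.continuousOn.comp_continuous (by unfold circlePt; fun_prop) (circlePt_mem hr)
  exact ENNReal.continuous_coe.comp this.nnnorm

lemma bounded_mem_MpClass {p : ℝ} (hp : 1 < p) {g : ℂ → ℂ} (hg : DifferentiableOn ℂ g unitDisk)
    (hb : ∀ z ∈ unitDisk, ‖g z‖ ≤ 1) : g ∈ MpClass p := by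
  refine ⟨hg, ?_⟩
  have h0 : ∀ θ, elogPlus (maxRad g θ) = 0 := by
    intro θ
    have h1 : maxRad g θ ≤ 1 := by
      unfold maxRad
      refine iSup₂_le fun r hr => ?_
      exact_mod_cast hb _ (circlePt_mem hr θ)
    refine le_antisymm ((elogPlus_mono h1).trans ?_) zero_le
    simp [elogPlus]
  simp [h0, ENNReal.zero_rpow_of_pos (by linarith : 0 < p)]

/-- The boundary majorant. -/
def bdMaj (f : ℂ → ℂ) (ζ : ℂ) : ℝ :=
  (elogPlus (⨆ r ∈ Set.Ico (0 : ℝ) 1, (‖f ((r : ℂ) * ζ)‖₊ : ℝ≥0∞))).toReal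

lemma bdMaj_circleMap (f : ℂ → ℂ) (θ : ℝ) :
    bdMaj f (circleMap 0 1 θ) = (elogPlus (maxRad f θ)).toReal := by
  simp [bdMaj, maxRad, circlePt, circleMap]

lemma lintegral_ne_top {p : ℝ} (hp : 1 < p) {f : ℂ → ℂ} (hf : f ∈ MpClass p) :
    ∫⁻ θ in Set.Ioc 0 (2 * π), elogPlus (maxRad f θ) ≠ ∞ := by
  have h1 : ∫⁻ θ in Set.Ioc 0 (2 * π), elogPlus (maxRad f θ) ^ p ≠ ∞ := by
    intro h
    have := hf.2
    rw [h, ENNReal.top_div_of_ne_top ENNReal.ofReal_ne_top] at this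
    exact lt_irrefl _ this
  have h2 : ∫⁻ θ in Set.Ioc 0 (2 * π), elogPlus (maxRad f θ) ≤
      ∫⁻ θ in Set.Ioc 0 (2 * π), (1 + elogPlus (maxRad f θ) ^ p) := by
    apply lintegral_mono
    intro θ
    show elogPlus (maxRad f θ) ≤ 1 + elogPlus (maxRad f θ) ^ p
    rcases le_total (elogPlus (maxRad f θ)) 1 with h | h
    · exact h.trans le_self_add
    · refine le_trans ?_ le_add_self
      simpa using ENNReal.rpow_le_rpow_of_exponent_le h hp.le
  refine ne_top_of_le_ne_top ?_ h2
  rw [lintegral_add_left measurable_const]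
  refine ENNReal.add_ne_top.2 ⟨?_, h1⟩
  simp [ENNReal.mul_ne_top]

lemma ae_ne_top {p : ℝ} (hp : 1 < p) {f : ℂ → ℂ} (hf : f ∈ MpClass p) :
    ∀ᵐ θ ∂(volume.restrict (Set.Ioc 0 (2 * π))), elogPlus (maxRad f θ) ≠ ∞ := by
  filter_upwards [ae_lt_top (elogPlus_mono.measurable.comp (measurable_maxRad hf.1))
    (lintegral_ne_top hp hf)] with θ h using h.ne

lemma circleIntegrable_bdMaj {p : ℝ} (hp : 1 < p) {f : ℂ → ℂ} (hf : f ∈ MpClass p) :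
    CircleIntegrable (bdMaj f) 0 1 := by
  unfold CircleIntegrable
  simp only [bdMaj_circleMap]
  rw [intervalIntegrable_iff_integrableOn_Ioc_of_le (by positivity)]
  exact integrable_toReal_of_lintegral_ne_top
    (elogPlus_mono.measurable.comp (measurable_maxRad hf.1)).aemeasurable (lintegral_ne_top hp hf)

lemma poisson_nonneg (f : ℂ → ℂ) {w : ℂ} (hw : w ∈ Metric.ball (0 : ℂ) 1) :
    0 ≤ Real.circleAverage ((Complex.re ∘ herglotzRieszKernel 0 w) • bdMaj f) 0 1 := by
  rw [Real.circleAverage_def]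
  refine smul_nonneg (by positivity) (intervalIntegral.integral_nonneg (by positivity) ?_)
  intro θ _
  exact mul_nonneg (reK_nonneg hw (by simp)) ENNReal.toReal_nonneg

lemma log_le_majorant {f : ℂ → ℂ} {R θ : ℝ} (hR : R ∈ Set.Ico (0 : ℝ) 1)
    (h : elogPlus (maxRad f θ) ≠ ∞) :
    Real.log ‖f ((R : ℂ) * circleMap 0 1 θ)‖ ≤ bdMaj f (circleMap 0 1 θ) := by
  rw [bdMaj_circleMap]
  have h1 : (‖f (circlePt R θ)‖₊ : ℝ≥0∞) ≤ maxRad f θ := le_iSup₂ (f := fun (r : ℝ)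
    (_ : r ∈ Set.Ico (0 : ℝ) 1) => (‖f (circlePt r θ)‖₊ : ℝ≥0∞)) R hR
  have h2 := ENNReal.toReal_mono h (elogPlus_mono h1)
  refine le_trans ?_ h2
  have h3 : (R : ℂ) * circleMap 0 1 θ = circlePt R θ := by simp [circlePt, circleMap]
  rw [h3, elogPlus, if_neg ENNReal.coe_ne_top, ENNReal.toReal_ofReal']
  exact le_max_left _ _

lemma norm_dilate_le {p : ℝ} (hp : 1 < p) {f : ℂ → ℂ} (hf : f ∈ MpClass p)
    {w : ℂ} (hw : w ∈ Metric.ball (0 : ℂ) 1) {R : ℝ} (hR : R ∈ Set.Ico (0 : ℝ) 1) :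
    ‖f ((R : ℂ) * w)‖ ≤
      Real.exp (Real.circleAverage ((Complex.re ∘ herglotzRieszKernel 0 w) • bdMaj f) 0 1) := by
  by_cases h0 : f ((R : ℂ) * w) = 0
  · rw [h0, norm_zero]; positivity
  have hF : AnalyticOnNhd ℂ (fun z => f ((R : ℂ) * z)) (Metric.closedBall 0 1) := by
    intro z hz
    have hz' : ‖z‖ ≤ 1 := by simpa using hz
    have : (R : ℂ) * z ∈ unitDisk := by
      simp only [unitDisk, mem_ball_zero_iff, norm_mul, Complex.norm_real, Real.norm_eq_abs,
        abs_of_nonneg hR.1]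
      nlinarith [hR.1, hR.2, norm_nonneg z]
    have h2 : AnalyticAt ℂ f ((R : ℂ) * z) :=
      (hf.1.analyticOnNhd Metric.isOpen_ball) _ this
    exact h2.fun_comp (f := fun z => (R : ℂ) * z) (by fun_prop)
  obtain ⟨hi, hle⟩ := log_norm_le_poisson hF hw h0
  rw [← Real.log_le_iff_le_exp (norm_pos_iff.2 h0)]
  refine hle.trans ?_
  rw [Real.circleAverage_def, Real.circleAverage_def]
  refine smul_le_smul_of_nonneg_left ?_ (by positivity)
  refine intervalIntegral.integral_mono_ae_restrict (by positivity) hi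
    ((circleIntegrable_bdMaj hp hf).continuousOn_smul (continuousOn_reK hw)) ?_
  rw [Filter.EventuallyLE, Measure.restrict_congr_set Ioc_ae_eq_Icc.symm]
  filter_upwards [ae_ne_top hp hf] with θ hθ
  exact mul_le_mul_of_nonneg_left (log_le_majorant hR hθ) (reK_nonneg hw (by simp))

lemma norm_le_exp_poisson {p : ℝ} (hp : 1 < p) {f : ℂ → ℂ} (hf : f ∈ MpClass p)
    {w : ℂ} (hw : w ∈ Metric.ball (0 : ℂ) 1) :
    ‖f w‖ ≤
      Real.exp (Real.circleAverage ((Complex.re ∘ herglotzRieszKernel 0 w) • bdMaj f) 0 1) := by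
  have hc : ContinuousAt f w := hf.1.continuousOn.continuousAt (Metric.isOpen_ball.mem_nhds hw)
  have ht : Tendsto (fun R : ℝ => (R : ℂ) * w) (𝓝[<] 1) (𝓝 w) := by
    have : Continuous fun R : ℝ => (R : ℂ) * w := by fun_prop
    have h := this.tendsto 1
    simp only [Complex.ofReal_one, one_mul] at h
    exact h.mono_left nhdsWithin_le_nhds
  refine le_of_tendsto (hc.tendsto.comp ht).norm ?_
  filter_upwards [Ico_mem_nhdsLT (zero_lt_one : (0 : ℝ) < 1)] with R hR
  exact norm_dilate_le hp hf hw hR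

end Helpers

/-- A nonzero ideal of `M^p` contains a bounded holomorphic function on the
unit disk which is not identically zero. -/
theorem nonzero_ideal_contains_bounded (p : ℝ) (hp : 1 < p)
    (I : Set (ℂ → ℂ)) (hI : IsIdealIn p I)
    (hnz : ∃ f ∈ I, ¬ Set.EqOn f 0 unitDisk) :
    ∃ f ∈ I, DifferentiableOn ℂ f unitDisk ∧ (∃ C : ℝ, ∀ z ∈ unitDisk, ‖f z‖ ≤ C) ∧
      ¬ Set.EqOn f 0 unitDisk := by
  obtain ⟨f, hfI, hf0⟩ := hnz
  have hf := hI.subset hfI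
  have hint := circleIntegrable_bdMaj hp hf
  have hintC : CircleIntegrable (fun ζ => (bdMaj f ζ : ℂ)) 0 1 := by
    simp only [CircleIntegrable, intervalIntegrable_iff] at hint ⊢
    exact Complex.ofRealCLM.integrable_comp hint
  let g : ℂ → ℂ := fun w => Complex.exp
    (-Real.circleAverage (fun ζ => herglotzRieszKernel 0 w ζ • (bdMaj f ζ : ℂ)) 0 1)
  have hgd : DifferentiableOn ℂ g unitDisk :=
    (differentiableOn_circleAverage_herglotzRieszKernel_smul hintC).neg.cexp
  have hgn : ∀ w ∈ unitDisk, ‖g w‖ = Real.exp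
      (-Real.circleAverage ((Complex.re ∘ herglotzRieszKernel 0 w) • bdMaj f) 0 1) := by
    intro w hw
    simp only [g, Complex.norm_exp, Complex.neg_re]
    rw [re_circleAverage_herglotzRieszKernel_smul hint hw]
  have hgM : g ∈ MpClass p := bounded_mem_MpClass hp hgd fun z hz => by
    rw [hgn z hz, Real.exp_le_one_iff]
    linarith [poisson_nonneg f hz]
  refine ⟨g * f, hI.mul_mem g hgM f hfI, hgd.mul hf.1, ⟨1, fun z hz => ?_⟩, fun h => hf0 ?_⟩
  · rw [Pi.mul_apply, norm_mul, hgn z hz]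
    calc _ ≤ Real.exp (-Real.circleAverage ((Complex.re ∘ herglotzRieszKernel 0 z) • bdMaj f) 0 1)
          * Real.exp (Real.circleAverage ((Complex.re ∘ herglotzRieszKernel 0 z) • bdMaj f) 0 1) :=
          mul_le_mul_of_nonneg_left (norm_le_exp_poisson hp hf hz) (Real.exp_nonneg _)
      _ = 1 := by rw [← Real.exp_add]; simp
  · intro z hz
    have := h hz
    simpa [g, Complex.exp_ne_zero] using this
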